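/- The projective special linear group PSL₂(𝔽₇) is not (1 | 2)-generated; that is, there do not exist elements h₁, h₂ generating PSL₂(𝔽₇) such that the commutator h₁h₂h₁⁻¹h₂⁻¹ has order 2. -/

import Mathlib

/-- In a simple group generated by `a, b`, if a set `S` is stable under conjugation by
`a`, `b` and their inverses and some nontrivial `u ∈ S` commutes with all of `S`, then `a, b`
commute. -/
theorem aux_core {G : Type*} [Group G] [IsSimpleGroup G] {a b : G}
    (hgen : ∀ K : Subgroup G, a ∈ K → b ∈ K → K = ⊤) (S : Set G)
    (ha : ∀ s ∈ S, a * s * a⁻¹ ∈ S ∧ a⁻¹ * s * a ∈ S)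
    (hb : ∀ s ∈ S, b * s * b⁻¹ ∈ S ∧ b⁻¹ * s * b ∈ S)
    {u : G} (hu : u ∈ S) (hu1 : u ≠ 1) (hc : ∀ s ∈ S, s * u = u * s) : a * b = b * a := by
  let K : Subgroup G :=
    { carrier := {g | ∀ s ∈ S, g * s * g⁻¹ ∈ S ∧ g⁻¹ * s * g ∈ S}
      one_mem' := by intro s hs; simpa using hs
      mul_mem' := by
        intro x y hx hy s hs
        refine ⟨?_, ?_⟩
        · have := (hx _ (hy s hs).1).1
          simpa [mul_assoc] using this
        · have := (hy _ (hx s hs).2).2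
          simpa [mul_assoc] using this
      inv_mem' := by
        intro x hx s hs
        refine ⟨?_, ?_⟩
        · simpa using (hx s hs).2
        · simpa using (hx s hs).1 }
  have hK : K = ⊤ := hgen K ha hb
  have hconj : ∀ g : G, g * u * g⁻¹ ∈ S := fun g => by
    have hg : g ∈ K := by rw [hK]; trivial
    exact (hg u hu).1
  have hN : Subgroup.normalClosure {u} = ⊤ := by
    rcases Subgroup.Normal.eq_bot_or_eq_top
      (Subgroup.normalClosure_normal (s := ({u} : Set G))) with h | h
    · exfalso
      apply hu1
      have : u ∈ Subgroup.normalClosure {u} := Subgroup.subset_normalClosure rfl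
      rw [h] at this
      simpa using this
    · exact h
  have hle : Subgroup.normalClosure {u} ≤ Subgroup.centralizer {u} := by
    rw [Subgroup.normalClosure, Subgroup.closure_le]
    intro x hx
    rw [Group.mem_conjugatesOfSet_iff] at hx
    obtain ⟨v, hv, hvx⟩ := hx
    rw [Set.mem_singleton_iff] at hv
    subst hv
    obtain ⟨g, rfl⟩ := isConj_iff.1 hvx
    rw [SetLike.mem_coe, Subgroup.mem_centralizer_singleton_iff]
    exact hc _ (hconj g)
  have hcen : u ∈ Subgroup.center G := by
    rw [Subgroup.mem_center_iff]
    intro g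
    have : g ∈ Subgroup.centralizer {u} := hle (by rw [hN]; trivial)
    exact Subgroup.mem_centralizer_singleton_iff.1 this
  rcases Subgroup.Normal.eq_bot_or_eq_top
    (inferInstance : (Subgroup.center G).Normal) with h | h
  · rw [h] at hcen
    exact absurd (by simpa using hcen) hu1
  · have : b ∈ Subgroup.center G := by rw [h]; trivial
    exact Subgroup.mem_center_iff.1 this a

/-- A simple group generated by two involutions is abelian. -/
theorem aux_dihedral {G : Type*} [Group G] [IsSimpleGroup G] {a b : G}
    (hgen : ∀ K : Subgroup G, a ∈ K → b ∈ K → K = ⊤)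
    (ha : a ^ 2 = 1) (hb : b ^ 2 = 1) : a * b = b * a := by
  by_contra hne
  have ha' : a * a = 1 := by rw [← pow_two, ha]
  have hb' : b * b = 1 := by rw [← pow_two, hb]
  have hai : a⁻¹ = a := inv_eq_of_mul_eq_one_left ha'
  have hbi : b⁻¹ = b := inv_eq_of_mul_eq_one_left hb'
  have h1 : a * (a * b) * a = b * a := by rw [← mul_assoc a a b, ha', one_mul]
  have h2 : a * (b * a) * a = a * b := by rw [mul_assoc, mul_assoc b a a, ha', mul_one]
  have h3 : b * (b * a) * b = a * b := by rw [← mul_assoc b b a, hb', one_mul]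
  have h4 : b * (a * b) * b = b * a := by rw [mul_assoc, mul_assoc a b b, hb', mul_one]
  refine hne (aux_core hgen {a * b, b * a} ?_ ?_ (u := a * b) (by simp) ?_ ?_)
  · rintro s (rfl | rfl) <;> simp [hai, h1, h2]
  · rintro s (rfl | rfl) <;> simp [hbi, h3, h4]
  · intro h
    apply hne
    have : b = a := by rw [← hai]; exact (inv_eq_of_mul_eq_one_right h).symm
    rw [this]
  · rintro s (rfl | rfl)
    · rfl
    · rw [mul_assoc, ← mul_assoc a a b, ha', one_mul, hb', mul_assoc, ← mul_assoc b b a, hb',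
        one_mul, ha']

/-- A simple quotient of the `(2,3,3)` triangle group is abelian. -/
theorem aux_tetrahedral {G : Type*} [Group G] [IsSimpleGroup G] {a b : G}
    (hgen : ∀ K : Subgroup G, a ∈ K → b ∈ K → K = ⊤)
    (ha : a ^ 2 = 1) (hb : b ^ 3 = 1) (hab : (a * b) ^ 3 = 1) : a * b = b * a := by
  by_contra hne
  have ha' : a * a = 1 := by rw [← pow_two, ha]
  have hai : a⁻¹ = a := inv_eq_of_mul_eq_one_left ha'
  have hbbb : b * (b * b) = 1 := by rw [← hb, pow_succ, pow_two, mul_assoc]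
  have hbi : b⁻¹ = b * b := inv_eq_of_mul_eq_one_right hbbb
  obtain ⟨d, hd⟩ : ∃ d, d = b * a * b⁻¹ := ⟨_, rfl⟩
  obtain ⟨e, he⟩ : ∃ e, e = b⁻¹ * a * b := ⟨_, rfl⟩
  have hdd : d * d = 1 := by
    rw [hd]; simp only [mul_assoc, inv_mul_cancel_left]; rw [← mul_assoc a a, ha']; simp
  have hee : e * e = 1 := by
    rw [he]; simp only [mul_assoc, mul_inv_cancel_left]; rw [← mul_assoc a a, ha']; simp
  have hbd : b * d * b⁻¹ = e := by
    have h : b⁻¹ * b⁻¹ = b := by rw [hbi]; simp only [mul_assoc]; rw [hbbb, mul_one]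
    have h' : b * b = b⁻¹ := hbi.symm
    calc b * d * b⁻¹ = (b * b) * a * (b⁻¹ * b⁻¹) := by rw [hd]; group
      _ = e := by rw [h, h', he]
  have hade : a * d * e = 1 := by
    rw [← hbd, hd]
    calc a * (b * a * b⁻¹) * (b * (b * a * b⁻¹) * b⁻¹)
        = (a * b) ^ 3 * (b ^ 3)⁻¹ := by simp only [pow_succ, pow_zero]; group
      _ = 1 := by rw [hab, hb]; simp
  have hdi : d⁻¹ = d := inv_eq_of_mul_eq_one_left hdd
  have hei : e⁻¹ = e := inv_eq_of_mul_eq_one_left hee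
  have had : a * d = e := by rw [← hei]; exact eq_inv_of_mul_eq_one_left hade
  have hda : d * a = e := by
    have := congrArg (·⁻¹) had
    simpa [hai, hdi, hei] using this
  have hae : a * e = d := by rw [← had, ← mul_assoc, ha', one_mul]
  have hea : e * a = d := by rw [← hda, mul_assoc, ha', mul_one]
  have hbe : b * e * b⁻¹ = a := by rw [he]; group
  have hbd' : b⁻¹ * d * b = a := by rw [hd]; group
  have hbe' : b⁻¹ * e * b = d := by rw [← hbd]; group
  refine hne (aux_core hgen {a, d, e} ?_ ?_ (u := a) (by simp) ?_ ?_)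
  · rintro s (rfl | rfl | rfl)
    · simp
    · rw [hai, had, hea]; simp
    · rw [hai, hae, hda]; simp
  · rintro s (rfl | rfl | rfl)
    · rw [← hd, ← he]; simp
    · rw [hbd, hbd']; simp
    · rw [hbe, hbe']; simp
  · intro h
    apply hne
    rw [h]; simp
  · rintro s (rfl | rfl | rfl)
    · rfl
    · rw [had, hda]
    · rw [hae, hea]

open Matrix in
theorem aux_mem_center {A : SpecialLinearGroup (Fin 2) (ZMod 7)} (r : ZMod 7)
    (h : (A : Matrix (Fin 2) (Fin 2) (ZMod 7)) = !![r, 0; 0, r]) :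
    A ∈ Subgroup.center (SpecialLinearGroup (Fin 2) (ZMod 7)) := by
  rw [Matrix.SpecialLinearGroup.mem_center_iff]
  refine ⟨r, ?_, ?_⟩
  · have := A.2
    rw [h, Matrix.det_fin_two_of] at this
    simp only [Fintype.card_fin]
    linear_combination this
  · rw [h]
    ext i j
    fin_cases i <;> fin_cases j <;> simp

open Matrix in
theorem aux_trace_zero {A : SpecialLinearGroup (Fin 2) (ZMod 7)}
    (h : (A : Matrix (Fin 2) (Fin 2) (ZMod 7)).trace = 0) :
    (A : ProjectiveSpecialLinearGroup (Fin 2) (ZMod 7)) ^ 2 = 1 := by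
  rw [← QuotientGroup.mk_pow, QuotientGroup.eq_one_iff]
  apply aux_mem_center (-1)
  have hd := A.2
  rw [Matrix.det_fin_two] at hd
  rw [Matrix.trace_fin_two] at h
  rw [Matrix.SpecialLinearGroup.coe_pow, pow_two]
  ext i j
  fin_cases i <;> fin_cases j <;> simp [Matrix.mul_apply, Fin.sum_univ_two]
  · linear_combination A.1 0 0 * h - hd
  · linear_combination A.1 0 1 * h
  · linear_combination A.1 1 0 * h
  · linear_combination A.1 1 1 * h - hd

open Matrix in
theorem aux_trace_one {A : SpecialLinearGroup (Fin 2) (ZMod 7)}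
    (h : (A : Matrix (Fin 2) (Fin 2) (ZMod 7)).trace ^ 2 = 1) :
    (A : ProjectiveSpecialLinearGroup (Fin 2) (ZMod 7)) ^ 3 = 1 := by
  rw [← QuotientGroup.mk_pow, QuotientGroup.eq_one_iff]
  apply aux_mem_center (-(A : Matrix (Fin 2) (Fin 2) (ZMod 7)).trace)
  have hd := A.2
  rw [Matrix.det_fin_two] at hd
  have hC : (A : Matrix (Fin 2) (Fin 2) (ZMod 7)) * A
      = A.1.trace • A.1 - 1 := by
    ext i j
    fin_cases i <;> fin_cases j <;>
      simp [Matrix.mul_apply, Fin.sum_univ_two, Matrix.trace_fin_two]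
    · linear_combination - hd
    · ring
    · ring
    · linear_combination - hd
  rw [Matrix.SpecialLinearGroup.coe_pow, pow_succ, pow_two, hC, sub_mul, smul_mul_assoc, hC, smul_sub,
    smul_smul, ← pow_two, h]
  ext i j
  fin_cases i <;> fin_cases j <;> simp

open Matrix in
theorem aux_order_two {A : SpecialLinearGroup (Fin 2) (ZMod 7)}
    (h : orderOf (A : ProjectiveSpecialLinearGroup (Fin 2) (ZMod 7)) = 2) :
    (A : Matrix (Fin 2) (Fin 2) (ZMod 7)).trace = 0 := by
  have : Fact (Nat.Prime 7) := ⟨by norm_num⟩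
  by_contra ht
  have h1 : (A : ProjectiveSpecialLinearGroup (Fin 2) (ZMod 7)) ≠ 1 := by
    intro h1
    rw [h1, orderOf_one] at h
    omega
  have h2 : (A : ProjectiveSpecialLinearGroup (Fin 2) (ZMod 7)) ^ 2 = 1 := by
    exact orderOf_dvd_iff_pow_eq_one.1 h.dvd
  apply h1
  rw [QuotientGroup.eq_one_iff]
  rw [← QuotientGroup.mk_pow, QuotientGroup.eq_one_iff,
    Matrix.SpecialLinearGroup.mem_center_iff] at h2
  obtain ⟨r, -, hr⟩ := h2
  rw [Matrix.SpecialLinearGroup.coe_pow, pow_two] at hr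
  rw [Matrix.trace_fin_two] at ht
  have e01 := congrFun (congrFun hr 0) 1
  have e10 := congrFun (congrFun hr 1) 0
  have e00 := congrFun (congrFun hr 0) 0
  have e11 := congrFun (congrFun hr 1) 1
  simp [Matrix.mul_apply, Fin.sum_univ_two] at e01 e10 e00 e11
  have f01 : A.1 0 1 = 0 := by
    apply (mul_eq_zero.1 _).resolve_left ht
    linear_combination -e01
  have f10 : A.1 1 0 = 0 := by
    apply (mul_eq_zero.1 _).resolve_left ht
    linear_combination -e10
  have f11 : A.1 1 1 = A.1 0 0 := by
    rw [← sub_eq_zero]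
    apply (mul_eq_zero.1 _).resolve_left ht
    linear_combination e00 - e11
  apply aux_mem_center (A.1 0 0)
  ext i j
  fin_cases i <;> fin_cases j <;> simp [f01, f10, f11]

open Matrix in
theorem aux_fricke (A B : SpecialLinearGroup (Fin 2) (ZMod 7)) :
    ((A * B * A⁻¹ * B⁻¹ : SpecialLinearGroup (Fin 2) (ZMod 7)) :
      Matrix (Fin 2) (Fin 2) (ZMod 7)).trace
    = A.1.trace ^ 2 + B.1.trace ^ 2 + (A * B).1.trace ^ 2
      - A.1.trace * B.1.trace * (A * B).1.trace - 2 := by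
  have hA := A.2
  have hB := B.2
  rw [Matrix.det_fin_two] at hA hB
  simp only [Matrix.SpecialLinearGroup.coe_mul, Matrix.SpecialLinearGroup.coe_inv, Matrix.adjugate_fin_two,
    Matrix.trace_fin_two, Matrix.mul_apply, Fin.sum_univ_two, Matrix.of_apply, Matrix.cons_val',
    Matrix.cons_val_zero, Matrix.cons_val_one, Matrix.cons_val_fin_one]
  linear_combination (A.1 0 0 + A.1 1 1) ^ 2 * hB + (B.1 0 0 + B.1 1 1) ^ 2 * hA
    - 2 * (A.1 0 0 * A.1 1 1 - A.1 0 1 * A.1 1 0) * hB - 2 * hA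

open Matrix in
theorem aux_trace_inv (A B : SpecialLinearGroup (Fin 2) (ZMod 7)) :
    (A * B⁻¹).1.trace = A.1.trace * B.1.trace - (A * B).1.trace := by
  simp only [Matrix.SpecialLinearGroup.coe_mul, Matrix.SpecialLinearGroup.coe_inv, Matrix.adjugate_fin_two,
    Matrix.trace_fin_two, Matrix.mul_apply, Fin.sum_univ_two, Matrix.of_apply, Matrix.cons_val',
    Matrix.cons_val_zero, Matrix.cons_val_one, Matrix.cons_val_fin_one]
  ring

theorem aux_triples : ∀ x y z : ZMod 7, x ^ 2 + y ^ 2 + z ^ 2 - x * y * z - 2 = 0 →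
    (x = 0 ∧ y = 0) ∨ (x = 0 ∧ z = 0) ∨ (y = 0 ∧ z = 0) ∨
    (x = 0 ∧ y ^ 2 = 1 ∧ z ^ 2 = 1) ∨ (y = 0 ∧ x ^ 2 = 1 ∧ z ^ 2 = 1) ∨
    (z = 0 ∧ x ^ 2 = 1 ∧ y ^ 2 = 1) ∨
    (x ^ 2 = 1 ∧ y ^ 2 = 1 ∧ x * y - z = 0) := by
  decide +kernel

/-- `PSL₂(𝔽₇)` is not `(1 | 2)`-generated. -/
theorem PSL2F7_not_one_two_generated :
    ¬ ∃ h₁ h₂ : Matrix.ProjectiveSpecialLinearGroup (Fin 2) (ZMod 7),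
        Subgroup.closure
          ({h₁, h₂} : Set (Matrix.ProjectiveSpecialLinearGroup (Fin 2) (ZMod 7))) = ⊤ ∧
        orderOf (h₁ * h₂ * h₁⁻¹ * h₂⁻¹) = 2 := by
  have : Fact (Nat.Prime 7) := ⟨by norm_num⟩
  have : IsSimpleGroup (Matrix.ProjectiveSpecialLinearGroup (Fin 2) (ZMod 7)) :=
    Matrix.ProjectiveSpecialLinearGroup.rank_two_simple (by simp)
  rintro ⟨a, b, hcl, hord⟩
  have hgen : ∀ K : Subgroup (Matrix.ProjectiveSpecialLinearGroup (Fin 2) (ZMod 7)),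
      a ∈ K → b ∈ K → K = ⊤ := by
    intro K ha hb
    rw [eq_top_iff, ← hcl, Subgroup.closure_le]
    rintro s (rfl | rfl) <;> assumption
  have hne : a * b ≠ b * a := by
    intro h
    rw [h] at hord
    simp at hord
  obtain ⟨A, rfl⟩ := QuotientGroup.mk_surjective a
  obtain ⟨B, rfl⟩ := QuotientGroup.mk_surjective b
  have ht := aux_order_two (A := A * B * A⁻¹ * B⁻¹) hord
  rw [aux_fricke] at ht
  have hBA : (B * A).1.trace = (A * B).1.trace := Matrix.trace_mul_comm _ _
  -- abstract the projective images
  have hz2 : (A * B).1.trace = 0 →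
      ((A : Matrix.ProjectiveSpecialLinearGroup (Fin 2) (ZMod 7)) * B) ^ 2 = 1 :=
    fun h => aux_trace_zero (A := A * B) h
  have hz3 : (A * B).1.trace ^ 2 = 1 →
      ((A : Matrix.ProjectiveSpecialLinearGroup (Fin 2) (ZMod 7)) * B) ^ 3 = 1 :=
    fun h => aux_trace_one (A := A * B) h
  have hz3' : (A * B).1.trace ^ 2 = 1 →
      ((B : Matrix.ProjectiveSpecialLinearGroup (Fin 2) (ZMod 7)) * A) ^ 3 = 1 :=
    fun h => aux_trace_one (A := B * A) ((congrArg (· ^ 2) hBA).trans h)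
  have hw2 : A.1.trace * B.1.trace - (A * B).1.trace = 0 →
      ((A : Matrix.ProjectiveSpecialLinearGroup (Fin 2) (ZMod 7)) *
        (B : Matrix.ProjectiveSpecialLinearGroup (Fin 2) (ZMod 7))⁻¹) ^ 2 = 1 :=
    fun h => aux_trace_zero (A := A * B⁻¹) ((aux_trace_inv A B).trans h)
  have hx2 := aux_trace_zero (A := A)
  have hx3 := aux_trace_one (A := A)
  have hy2 := aux_trace_zero (A := B)
  have hy3 := aux_trace_one (A := B)
  generalize (A : Matrix.ProjectiveSpecialLinearGroup (Fin 2) (ZMod 7)) = a at *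
  generalize (B : Matrix.ProjectiveSpecialLinearGroup (Fin 2) (ZMod 7)) = b at *
  rcases aux_triples _ _ _ ht with ⟨h1, h2⟩ | ⟨h1, h2⟩ | ⟨h1, h2⟩ | ⟨h1, h2, h3⟩ |
    ⟨h1, h2, h3⟩ | ⟨h1, h2, h3⟩ | ⟨h1, h2, h3⟩
  · exact hne (aux_dihedral hgen (hx2 h1) (hy2 h2))
  · have := aux_dihedral (a := a) (b := a * b) (fun K h h' => hgen K h
      (by simpa using K.mul_mem (K.inv_mem h) h')) (hx2 h1) (hz2 h2)
    rw [mul_assoc] at this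
    exact hne (mul_left_cancel this)
  · have := aux_dihedral (a := b) (b := a * b) (fun K h h' => hgen K
      (by simpa using K.mul_mem h' (K.inv_mem h)) h) (hy2 h1) (hz2 h2)
    rw [← mul_assoc] at this
    exact hne (mul_right_cancel this).symm
  · exact hne (aux_tetrahedral hgen (hx2 h1) (hy3 h2) (hz3 h3))
  · exact hne (aux_tetrahedral (fun K h h' => hgen K h' h) (hy2 h1) (hx3 h2) (hz3' h3)).symm
  · have := aux_tetrahedral (a := a * b) (b := b⁻¹) (fun K h h' => hgen K
      (by simpa using K.mul_mem h h') (by simpa using h')) (hz2 h1)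
      (by rw [inv_pow, hy3 h3, inv_one]) (by simpa using hx3 h2)
    apply hne
    rw [mul_inv_cancel_right] at this
    nth_rewrite 2 [this]
    group
  · have := aux_tetrahedral (a := a * b⁻¹) (b := b) (fun K h h' => hgen K
      (by simpa using K.mul_mem h h') h') (hw2 h3) (hy3 h2) (by simpa using hx3 h1)
    apply hne
    rw [inv_mul_cancel_right] at this
    nth_rewrite 1 [this]
    group
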